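/- Let d ≥ 3 and m ≥ 0 be integers and let l > 0. For every Schwartz function φ on ℝ^d one has −(1/(m+1)) ∫_{ℝ^d} |x|^{−d} (log(|x|/l))^{m+1} (x·∇φ(x)) dx = − Σ_{k=1}^{m+1} (m!/k!) (d−2)^{k−m−2} ∫_{ℝ^d} |x|^{−d+2} (log(|x|/l))^{k} (Δφ)(x) dx + (m!/(d−2)^{m+1}) Ω_d φ(0); all integrals are absolutely convergent. (In distributional form: R_d[r^{−d} log^m(r/l)] = − Σ_{k=1}^{m+1} (m!/k!) (d−2)^{−m+k−2} Δ(r^{−d+2} log^k(r/l)) + (m!/(d−2)^{m+1}) Ω_d δ.) -/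

import Mathlib

open MeasureTheory Real SchwartzMap

noncomputable section

/-- The Laplacian of a function on `ℝ^d`, as the sum of repeated second partial
derivatives in the coordinate directions. -/
def lapl (d : ℕ) (f : EuclideanSpace ℝ (Fin d) → ℝ) (x : EuclideanSpace ℝ (Fin d)) : ℝ :=
  ∑ i : Fin d,
    fderiv ℝ (fun y => fderiv ℝ f y (EuclideanSpace.single i 1)) x (EuclideanSpace.single i 1)

/-- The surface area of the unit sphere in `ℝ^d`. -/
def Omega (d : ℕ) : ℝ := 2 * Real.pi ^ ((d : ℝ) / 2) / Real.Gamma ((d : ℝ) / 2)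


/-- powers of the log are controlled by small powers -/
lemma abs_log_pow_le (k : ℕ) {y : ℝ} (hy : 0 < y) :
    |Real.log y| ^ k ≤ 2 ^ k * k.factorial * (y ^ (1/2 : ℝ) + y ^ (-(1/2) : ℝ)) := by
  have h1 := Real.pow_div_factorial_le_exp (|Real.log y| / 2) (by positivity) k
  have hk : (0:ℝ) < k.factorial := by exact_mod_cast k.factorial_pos
  rw [div_le_iff₀ hk, div_pow, div_le_iff₀ (by positivity)] at h1
  have h2 : Real.exp (|Real.log y| / 2) ≤ y ^ (1/2 : ℝ) + y ^ (-(1/2) : ℝ) := by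
    rw [Real.rpow_def_of_pos hy, Real.rpow_def_of_pos hy]
    rcases abs_cases (Real.log y) with ⟨h, _⟩ | ⟨h, _⟩ <;> rw [h]
    · have := Real.exp_pos (Real.log y * -(1/2))
      rw [show Real.log y / 2 = Real.log y * (1/2) by ring]; linarith
    · have := Real.exp_pos (Real.log y * (1/2))
      rw [show -Real.log y / 2 = Real.log y * (-(1/2)) by ring]; linarith
  calc _ ≤ _ := h1
    _ ≤ (y ^ (1/2 : ℝ) + y ^ (-(1/2) : ℝ)) * k.factorial * 2 ^ k := by gcongr
    _ = _ := by ring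

lemma log_bound (k : ℕ) {l : ℝ} (hl : 0 < l) : ∃ C : ℝ, 0 ≤ C ∧ ∀ s : ℝ, 0 < s →
    |Real.log (s / l)| ^ k ≤ C * (s ^ (1/2 : ℝ) + s ^ (-(1/2) : ℝ)) := by
  refine ⟨2 ^ k * k.factorial * (l ^ (1/2 : ℝ) + l ^ (-(1/2) : ℝ)), by positivity, fun s hs => ?_⟩
  refine (abs_log_pow_le k (div_pos hs hl)).trans ?_
  rw [Real.div_rpow hs.le hl.le, Real.div_rpow hs.le hl.le, mul_assoc (2 ^ k * (k.factorial : ℝ))]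
  gcongr
  have h1 : 0 < s ^ (1/2 : ℝ) := by positivity
  have h2 : 0 < s ^ (-(1/2) : ℝ) := by positivity
  have h3 : 0 < l ^ (1/2 : ℝ) := by positivity
  have h4 : 0 < l ^ (-(1/2) : ℝ) := by positivity
  have e1 : s ^ (1/2 : ℝ) / l ^ (1/2 : ℝ) = s ^ (1/2 : ℝ) * l ^ (-(1/2) : ℝ) := by
    rw [Real.rpow_neg hl.le]; rfl
  have e2 : s ^ (-(1/2) : ℝ) / l ^ (-(1/2) : ℝ) = s ^ (-(1/2) : ℝ) * l ^ ((1/2) : ℝ) := by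
    rw [Real.rpow_neg hl.le, div_inv_eq_mul]
  rw [e1, e2]
  nlinarith [mul_pos h1 h3, mul_pos h2 h4]

/-- the dominating radial weight -/
def wt (q r : ℝ) : ℝ := r ^ (q + 1/2) + r ^ (q - 1/2)

lemma wt_bound (k : ℕ) {l : ℝ} (hl : 0 < l) : ∃ C : ℝ, 0 ≤ C ∧ ∀ q s r : ℝ, 0 < r → r ≤ s →
    q + 1/2 ≤ 0 → |s ^ q * Real.log (s / l) ^ k| ≤ C * wt q r := by
  obtain ⟨C, hC, h⟩ := log_bound k hl
  refine ⟨C, hC, fun q s r hr hrs hq => ?_⟩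
  have hs : 0 < s := hr.trans_le hrs
  rw [abs_mul, abs_pow, abs_of_pos (Real.rpow_pos_of_pos hs q)]
  calc _ ≤ s ^ q * (C * (s ^ (1/2 : ℝ) + s ^ (-(1/2) : ℝ))) := by gcongr; exact h s hs
    _ = C * (s ^ (q + 1/2) + s ^ (q - 1/2)) := by
        rw [sub_eq_add_neg, Real.rpow_add hs, Real.rpow_add hs]; ring
    _ ≤ _ := by
        unfold wt
        gcongr C * (?_ + ?_)
        · exact Real.rpow_le_rpow_of_nonpos hr hrs hq
        · exact Real.rpow_le_rpow_of_nonpos hr hrs (by linarith)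

lemma wt_nonneg (q : ℝ) {r : ℝ} (hr : 0 ≤ r) : 0 ≤ wt q r := by unfold wt; positivity

lemma integrable_rpow_schwartz {d : ℕ} (hd : 3 ≤ d) {F : Type*} [NormedAddCommGroup F]
    [NormedSpace ℝ F] (ψ : SchwartzMap (EuclideanSpace ℝ (Fin d)) F) {p : ℝ} (hp : -(d:ℝ) < p)
    (hp0 : p ≤ 0) : Integrable (fun x : EuclideanSpace ℝ (Fin d) => ‖x‖ ^ p * ‖ψ x‖) := by
  have : Nonempty (Fin d) := ⟨⟨0, by omega⟩⟩
  have : Nontrivial (EuclideanSpace ℝ (Fin d)) := inferInstance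
  have hball : IntegrableOn (fun x : EuclideanSpace ℝ (Fin d) => ‖x‖ ^ p) (Metric.ball 0 1) := by
    rw [integrableOn_fun_norm_addHaar volume (f := fun r : ℝ => r ^ p)]
    have : IntegrableOn (fun y : ℝ => y ^ ((d:ℝ) - 1 + p)) (Set.Ioo 0 1) := by
      rw [intervalIntegral.integrableOn_Ioo_rpow_iff one_pos]; linarith
    refine this.congr_fun (fun y hy => ?_) measurableSet_Ioo
    simp only [finrank_euclideanSpace, Fintype.card_fin, smul_eq_mul]
    rw [Real.rpow_add hy.1, ← Real.rpow_natCast, Nat.cast_sub (by omega)]; simp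
  obtain ⟨C, hC⟩ : ∃ C : ℝ, ∀ x, ‖ψ x‖ ≤ C := by
    obtain ⟨C, hC⟩ := ψ.decay 0 0
    exact ⟨C, fun x => by simpa using hC.2 x⟩
  have hdom := ((integrable_indicator_iff Metric.isOpen_ball.measurableSet).2
    hball).const_mul C |>.add ψ.integrable.norm
  refine hdom.mono' ?_ (.of_forall fun x => ?_)
  · have := ψ.continuous
    refine AEStronglyMeasurable.mul ?_ this.norm.aestronglyMeasurable
    exact (measurable_norm.pow_const p).aestronglyMeasurable
  · have h0 : 0 ≤ ‖x‖ ^ p := by positivity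
    rw [Real.norm_of_nonneg (by positivity)]
    by_cases hx : x ∈ Metric.ball (0 : EuclideanSpace ℝ (Fin d)) 1
    · simp only [Pi.add_apply, Set.indicator_of_mem hx]
      nlinarith [hC x, norm_nonneg (ψ x)]
    · simp only [Pi.add_apply, Set.indicator_of_notMem hx]
      have : 1 ≤ ‖x‖ := by simpa using hx
      have := Real.rpow_le_one_of_one_le_of_nonpos this hp0
      nlinarith [norm_nonneg (ψ x)]

lemma integrable_wt {d : ℕ} (hd : 3 ≤ d) {F : Type*} [NormedAddCommGroup F]
    [NormedSpace ℝ F] (ψ : SchwartzMap (EuclideanSpace ℝ (Fin d)) F) {q : ℝ}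
    (hq : -(d:ℝ) < q - 1/2) (hq0 : q + 1/2 ≤ 0) :
    Integrable (fun x : EuclideanSpace ℝ (Fin d) => wt q ‖x‖ * ‖ψ x‖) := by
  have h1 := integrable_rpow_schwartz hd ψ (p := q + 1/2) (by linarith) hq0
  have h2 := integrable_rpow_schwartz hd ψ (p := q - 1/2) hq (by linarith)
  refine (h1.add h2).congr (.of_forall fun x => ?_)
  simp [wt]; ring


/-- regularised norm -/
def sE {d : ℕ} (ε : ℝ) (x : EuclideanSpace ℝ (Fin d)) : ℝ := √(‖x‖ ^ 2 + ε)

/-- regularised kernel -/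
def KE {d : ℕ} (l q : ℝ) (k : ℕ) (ε : ℝ) (x : EuclideanSpace ℝ (Fin d)) : ℝ :=
  sE ε x ^ q * Real.log (sE ε x / l) ^ k

lemma sE_zero {d : ℕ} (x : EuclideanSpace ℝ (Fin d)) : sE 0 x = ‖x‖ := by
  simp [sE]

lemma le_sE {d : ℕ} {ε : ℝ} (hε : 0 ≤ ε) (x : EuclideanSpace ℝ (Fin d)) : ‖x‖ ≤ sE ε x :=
  Real.le_sqrt_of_sq_le (by linarith)

lemma sE_pos {d : ℕ} {ε : ℝ} (hε : 0 < ε) (x : EuclideanSpace ℝ (Fin d)) : 0 < sE ε x :=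
  Real.sqrt_pos.2 (by positivity)

lemma measurable_KE {d : ℕ} (l q : ℝ) (k : ℕ) (ε : ℝ) :
    Measurable (KE (d := d) l q k ε) := by
  unfold KE sE
  have h : Measurable (fun x : EuclideanSpace ℝ (Fin d) => √(‖x‖ ^ 2 + ε)) := by fun_prop
  exact (h.pow_const q).mul ((Real.measurable_log.comp (h.div_const l)).pow_const k)

lemma ae_ne_zero {d : ℕ} (hd : 3 ≤ d) : ∀ᵐ x : EuclideanSpace ℝ (Fin d), x ≠ 0 := by
  have : Nonempty (Fin d) := ⟨⟨0, by omega⟩⟩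
  exact (measure_eq_zero_iff_ae_notMem.1 (measure_singleton (0 : EuclideanSpace ℝ (Fin d))))

lemma domA {d : ℕ} (hd : 3 ≤ d) (k : ℕ) {l : ℝ} (hl : 0 < l) : ∃ C : ℝ, 0 ≤ C ∧
    ∀ (ψ : SchwartzMap (EuclideanSpace ℝ (Fin d)) ℝ) (ε : ℝ), 0 ≤ ε → ∀ x, x ≠ 0 →
      ‖KE l (-(d:ℝ) + 2) k ε x * ψ x‖ ≤ C * (wt (-(d:ℝ) + 2) ‖x‖ * ‖ψ x‖) := by
  obtain ⟨C, hC, h⟩ := wt_bound k hl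
  refine ⟨C, hC, fun ψ ε hε x hx => ?_⟩
  have hd' : (3:ℝ) ≤ d := by exact_mod_cast hd
  rw [norm_mul, ← mul_assoc]
  gcongr
  exact h _ _ _ (norm_pos_iff.2 hx) (le_sE hε x) (by linarith)

lemma integrableA {d : ℕ} (hd : 3 ≤ d) (k : ℕ) {l : ℝ} (hl : 0 < l)
    (ψ : SchwartzMap (EuclideanSpace ℝ (Fin d)) ℝ) {ε : ℝ} (hε : 0 ≤ ε) :
    Integrable (fun x => KE l (-(d:ℝ) + 2) k ε x * ψ x) := by
  have hd' : (3:ℝ) ≤ d := by exact_mod_cast hd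
  obtain ⟨C, hC, h⟩ := domA hd k hl
  refine ((integrable_wt hd ψ (q := -(d:ℝ) + 2) (by linarith) (by linarith)).const_mul C).mono'
    ((measurable_KE _ _ _ _).aestronglyMeasurable.mul ψ.continuous.aestronglyMeasurable) ?_
  filter_upwards [ae_ne_zero hd] with x hx using h ψ ε hε x hx

lemma tendsto_KE {d : ℕ} (k : ℕ) {l : ℝ} (hl : 0 < l) (q : ℝ) {x : EuclideanSpace ℝ (Fin d)}
    (hx : x ≠ 0) : Filter.Tendsto (fun ε => KE l q k ε x) (nhdsWithin 0 (Set.Ioi 0))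
      (nhds (KE l q k 0 x)) := by
  have hs : ContinuousAt (fun ε => sE ε x) 0 := by unfold sE; fun_prop
  have h0 : sE 0 x ≠ 0 := by rw [sE_zero]; exact norm_ne_zero_iff.2 hx
  have : ContinuousAt (fun ε => KE l q k ε x) 0 := by
    unfold KE
    refine (hs.rpow_const (.inl h0)).mul (((hs.div_const l).log ?_).pow k)
    exact div_ne_zero h0 hl.ne'
  exact this.tendsto.mono_left nhdsWithin_le_nhds

lemma limitA {d : ℕ} (hd : 3 ≤ d) (k : ℕ) {l : ℝ} (hl : 0 < l)
    (ψ : SchwartzMap (EuclideanSpace ℝ (Fin d)) ℝ) :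
    Filter.Tendsto (fun ε => ∫ x, KE l (-(d:ℝ) + 2) k ε x * ψ x) (nhdsWithin 0 (Set.Ioi 0))
      (nhds (∫ x, KE l (-(d:ℝ) + 2) k 0 x * ψ x)) := by
  have hd' : (3:ℝ) ≤ d := by exact_mod_cast hd
  obtain ⟨C, hC, h⟩ := domA hd k hl
  refine tendsto_integral_filter_of_dominated_convergence _ ?_ ?_
    ((integrable_wt hd ψ (q := -(d:ℝ) + 2) (by linarith) (by linarith)).const_mul C) ?_
  · filter_upwards [self_mem_nhdsWithin] with ε hε
    exact (integrableA hd k hl ψ (le_of_lt hε)).1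
  · filter_upwards [self_mem_nhdsWithin] with ε hε
    filter_upwards [ae_ne_zero hd] with x hx using h ψ ε (le_of_lt hε) x hx
  · filter_upwards [ae_ne_zero hd] with x hx using (tendsto_KE k hl _ hx).mul_const _

lemma domB {d : ℕ} (hd : 3 ≤ d) (k : ℕ) {l : ℝ} (hl : 0 < l) : ∃ C : ℝ, 0 ≤ C ∧
    ∀ (v w : EuclideanSpace ℝ (Fin d) → ℝ) (_ : ∀ x, |v x| ≤ ‖x‖ * w x) (ε : ℝ), 0 ≤ ε → ∀ x, x ≠ 0 →
      ‖KE l (-(d:ℝ)) k ε x * v x‖ ≤ C * (wt (-(d:ℝ) + 1) ‖x‖ * w x) := by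
  obtain ⟨C, hC, h⟩ := wt_bound k hl
  refine ⟨C, hC, fun v w hv ε hε x hx => ?_⟩
  have hd' : (3:ℝ) ≤ d := by exact_mod_cast hd
  have hx' := norm_pos_iff.2 hx
  have e : wt (-(d:ℝ) + 1) ‖x‖ = wt (-(d:ℝ)) ‖x‖ * ‖x‖ := by
    unfold wt
    rw [add_mul, ← Real.rpow_add_one hx'.ne', ← Real.rpow_add_one hx'.ne']
    ring_nf
  rw [norm_mul, e, mul_assoc, ← mul_assoc C]
  refine mul_le_mul (h _ _ _ hx' (le_sE hε x) (by linarith)) (hv x) (norm_nonneg _) ?_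
  exact mul_nonneg hC (wt_nonneg _ hx'.le)

lemma integrableB {d : ℕ} (hd : 3 ≤ d) (k : ℕ) {l : ℝ} (hl : 0 < l) {F : Type*}
    [NormedAddCommGroup F] [NormedSpace ℝ F]
    (Ψ : SchwartzMap (EuclideanSpace ℝ (Fin d)) F) {v : EuclideanSpace ℝ (Fin d) → ℝ}
    (hvc : Continuous v) (hv : ∀ x, |v x| ≤ ‖x‖ * ‖Ψ x‖) {ε : ℝ} (hε : 0 ≤ ε) :
    Integrable (fun x => KE l (-(d:ℝ)) k ε x * v x) := by
  have hd' : (3:ℝ) ≤ d := by exact_mod_cast hd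
  obtain ⟨C, hC, h⟩ := domB hd k hl
  refine ((integrable_wt hd Ψ (q := -(d:ℝ) + 1) (by linarith) (by linarith)).const_mul C).mono'
    ((measurable_KE _ _ _ _).aestronglyMeasurable.mul hvc.aestronglyMeasurable) ?_
  filter_upwards [ae_ne_zero hd] with x hx using h v _ hv ε hε x hx

lemma limitB {d : ℕ} (hd : 3 ≤ d) (k : ℕ) {l : ℝ} (hl : 0 < l) {F : Type*}
    [NormedAddCommGroup F] [NormedSpace ℝ F]
    (Ψ : SchwartzMap (EuclideanSpace ℝ (Fin d)) F) {v : EuclideanSpace ℝ (Fin d) → ℝ}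
    (hvc : Continuous v) (hv : ∀ x, |v x| ≤ ‖x‖ * ‖Ψ x‖) :
    Filter.Tendsto (fun ε => ∫ x, KE l (-(d:ℝ)) k ε x * v x) (nhdsWithin 0 (Set.Ioi 0))
      (nhds (∫ x, KE l (-(d:ℝ)) k 0 x * v x)) := by
  have hd' : (3:ℝ) ≤ d := by exact_mod_cast hd
  obtain ⟨C, hC, h⟩ := domB hd k hl
  refine tendsto_integral_filter_of_dominated_convergence _ ?_ ?_
    ((integrable_wt hd Ψ (q := -(d:ℝ) + 1) (by linarith) (by linarith)).const_mul C) ?_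
  · filter_upwards [self_mem_nhdsWithin] with ε hε
    exact (integrableB hd k hl Ψ hvc hv (le_of_lt hε)).1
  · filter_upwards [self_mem_nhdsWithin] with ε hε
    filter_upwards [ae_ne_zero hd] with x hx using h v _ hv ε (le_of_lt hε) x hx
  · filter_upwards [ae_ne_zero hd] with x hx using (tendsto_KE k hl _ hx).mul_const _

lemma hasFDerivAt_KE {d : ℕ} (k : ℕ) {l : ℝ} (hl : 0 < l) {ε : ℝ} (hε : 0 < ε)
    (x : EuclideanSpace ℝ (Fin d)) :
    HasFDerivAt (KE l (-(d:ℝ) + 2) k ε)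
      (((-(d:ℝ) + 2) * KE l (-(d:ℝ)) k ε x + k * KE l (-(d:ℝ)) (k - 1) ε x) • innerSL ℝ x) x := by
  have hs := sE_pos hε x
  have h1 : HasFDerivAt (fun y : EuclideanSpace ℝ (Fin d) => ‖y‖ ^ 2 + ε) (2 • innerSL ℝ x) x :=
    (hasStrictFDerivAt_norm_sq x).hasFDerivAt.add_const ε
  have hne : ‖x‖ ^ 2 + ε ≠ 0 := by positivity
  have h2 : HasFDerivAt (sE ε) ((1 / (2 * sE ε x)) • (2 • innerSL ℝ x)) x := h1.sqrt hne
  have h3 : HasDerivAt (fun s : ℝ => s ^ (-(d:ℝ) + 2) * Real.log (s / l) ^ k)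
      ((-(d:ℝ) + 2) * sE ε x ^ (-(d:ℝ) + 2 - 1) * Real.log (sE ε x / l) ^ k +
        sE ε x ^ (-(d:ℝ) + 2) * (k * Real.log (sE ε x / l) ^ (k - 1) * (1 / l / (sE ε x / l))))
      (sE ε x) := by
    generalize sE ε x = s at hs
    refine (Real.hasDerivAt_rpow_const (.inl hs.ne')).mul ?_
    exact (((hasDerivAt_id s).div_const l).log (div_pos hs hl).ne').pow k
  have h4 := h3.comp_hasFDerivAt x h2
  refine h4.congr_fderiv ?_
  have e1 : sE ε x ^ (-(d:ℝ) + 2 - 1) = sE ε x ^ (-(d:ℝ)) * sE ε x := by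
    rw [← Real.rpow_add_one hs.ne']; ring_nf
  have e2 : sE ε x ^ (-(d:ℝ) + 2) = sE ε x ^ (-(d:ℝ)) * sE ε x * sE ε x := by
    rw [← Real.rpow_add_one hs.ne', ← Real.rpow_add_one hs.ne']; ring_nf
  rw [e1, e2]
  ext v
  simp only [KE, smul_apply, smul_eq_mul, nsmul_eq_mul, Nat.cast_ofNat]
  field_simp

lemma ibp_i {d : ℕ} (hd : 3 ≤ d) (k : ℕ) {l : ℝ} (hl : 0 < l) {ε : ℝ} (hε : 0 < ε)
    (g : SchwartzMap (EuclideanSpace ℝ (Fin d)) ℝ) (i : Fin d) :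
    ∫ x, KE l (-(d:ℝ) + 2) k ε x * fderiv ℝ g x (EuclideanSpace.single i 1) =
      ((d:ℝ) - 2) * (∫ x, KE l (-(d:ℝ)) k ε x * (x i * g x)) -
        k * ∫ x, KE l (-(d:ℝ)) (k - 1) ε x * (x i * g x) := by
  have hvc : Continuous (fun x : EuclideanSpace ℝ (Fin d) => x i * g x) := by
    have := g.continuous
    fun_prop
  have hv : ∀ x : EuclideanSpace ℝ (Fin d), |x i * g x| ≤ ‖x‖ * ‖g x‖ := fun x => by
    rw [abs_mul]
    gcongr
    · simpa using PiLp.norm_apply_le x i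
    · simp
  have hB1 := integrableB hd k hl g hvc hv hε.le
  have hB2 := integrableB hd (k-1) hl g hvc hv hε.le
  have e : ∀ x, fderiv ℝ (KE l (-(d:ℝ) + 2) k ε) x (EuclideanSpace.single i 1) * g x =
      -((d:ℝ) - 2) * (KE l (-(d:ℝ)) k ε x * (x i * g x)) +
        k * (KE l (-(d:ℝ)) (k - 1) ε x * (x i * g x)) := fun x => by
    rw [(hasFDerivAt_KE k hl hε x).fderiv]
    simp only [smul_apply, smul_eq_mul, innerSL_apply_apply,
      EuclideanSpace.inner_single_right]
    simp
    ring
  have hI := (hB1.const_mul (-((d:ℝ) - 2))).add (hB2.const_mul (k:ℝ))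
  rw [integral_mul_fderiv_eq_neg_fderiv_mul_of_integrable]
  · simp_rw [e]
    rw [integral_add (hB1.const_mul _) (hB2.const_mul _), integral_const_mul, integral_const_mul]
    ring
  · exact hI.congr (.of_forall fun x => (e x).symm)
  · exact integrableA hd k hl (SchwartzMap.evalCLM ℝ _ _ (EuclideanSpace.single i 1)
      (SchwartzMap.fderivCLM ℝ _ _ g)) hε.le
  · exact integrableA hd k hl g hε.le
  · exact fun x _ => (hasFDerivAt_KE k hl hε x).differentiableAt
  · exact fun x _ => g.differentiableAt

/-- partial derivative as a Schwartz function -/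
def pd {d : ℕ} (φ : SchwartzMap (EuclideanSpace ℝ (Fin d)) ℝ) (i : Fin d) :
    SchwartzMap (EuclideanSpace ℝ (Fin d)) ℝ :=
  SchwartzMap.evalCLM ℝ _ _ (EuclideanSpace.single i 1) (SchwartzMap.fderivCLM ℝ _ _ φ)

lemma pd_coe {d : ℕ} (φ : SchwartzMap (EuclideanSpace ℝ (Fin d)) ℝ) (i : Fin d) :
    ⇑(pd φ i) = fun y => fderiv ℝ φ y (EuclideanSpace.single i 1) := rfl

/-- Laplacian as a Schwartz function -/
def lapS {d : ℕ} (φ : SchwartzMap (EuclideanSpace ℝ (Fin d)) ℝ) :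
    SchwartzMap (EuclideanSpace ℝ (Fin d)) ℝ := ∑ i, pd (pd φ i) i

lemma lapS_apply {d : ℕ} (φ : SchwartzMap (EuclideanSpace ℝ (Fin d)) ℝ)
    (x : EuclideanSpace ℝ (Fin d)) : lapS φ x = lapl d φ x := by
  simp only [lapS, lapl, sum_apply]
  rfl

lemma fderiv_self {d : ℕ} (φ : SchwartzMap (EuclideanSpace ℝ (Fin d)) ℝ)
    (x : EuclideanSpace ℝ (Fin d)) : fderiv ℝ φ x x = ∑ i, x i * pd φ i x := by
  conv_lhs => enter [2]; rw [← (EuclideanSpace.basisFun (Fin d) ℝ).sum_repr x]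
  simp [map_sum, pd_coe]

lemma rad_cont {d : ℕ} (φ : SchwartzMap (EuclideanSpace ℝ (Fin d)) ℝ) :
    Continuous (fun x => fderiv ℝ φ x x) := by
  have : Continuous (fun x => fderiv ℝ φ x) := (SchwartzMap.fderivCLM ℝ _ _ φ).continuous
  fun_prop

lemma rad_bound {d : ℕ} (φ : SchwartzMap (EuclideanSpace ℝ (Fin d)) ℝ)
    (x : EuclideanSpace ℝ (Fin d)) :
    |fderiv ℝ φ x x| ≤ ‖x‖ * ‖SchwartzMap.fderivCLM ℝ _ _ φ x‖ := by
  rw [mul_comm]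
  exact (fderiv ℝ φ x).le_opNorm x

lemma ibp_eps {d : ℕ} (hd : 3 ≤ d) (k : ℕ) {l : ℝ} (hl : 0 < l) {ε : ℝ} (hε : 0 < ε)
    (φ : SchwartzMap (EuclideanSpace ℝ (Fin d)) ℝ) :
    ∫ x, KE l (-(d:ℝ) + 2) k ε x * lapS φ x =
      ((d:ℝ) - 2) * (∫ x, KE l (-(d:ℝ)) k ε x * fderiv ℝ φ x x) -
        k * ∫ x, KE l (-(d:ℝ)) (k - 1) ε x * fderiv ℝ φ x x := by
  have hI : ∀ k i, Integrable (fun x : EuclideanSpace ℝ (Fin d) =>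
      KE l (-(d:ℝ)) k ε x * (x i * pd φ i x)) := fun k i => by
    refine integrableB hd k hl (pd φ i) ?_ ?_ hε.le
    · have := (pd φ i).continuous
      fun_prop
    · intro x
      rw [abs_mul]
      gcongr
      · simpa using PiLp.norm_apply_le x i
      · simp
  have hB : ∀ k, ∫ x, KE l (-(d:ℝ)) k ε x * fderiv ℝ φ x x =
      ∑ i, ∫ x, KE l (-(d:ℝ)) k ε x * (x i * pd φ i x) := fun k => by
    rw [← integral_finsetSum _ (fun i _ => hI k i)]
    simp_rw [fderiv_self, Finset.mul_sum]
  rw [hB, hB, Finset.mul_sum, Finset.mul_sum, ← Finset.sum_sub_distrib]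
  simp_rw [← ibp_i hd k hl hε]
  rw [← integral_finsetSum]
  · simp_rw [← Finset.mul_sum, lapS, sum_apply]
    rfl
  · exact fun i _ => integrableA hd k hl (pd (pd φ i) i) hε.le

lemma ibp_zero {d : ℕ} (hd : 3 ≤ d) (k : ℕ) {l : ℝ} (hl : 0 < l)
    (φ : SchwartzMap (EuclideanSpace ℝ (Fin d)) ℝ) :
    ∫ x, KE l (-(d:ℝ) + 2) k 0 x * lapS φ x =
      ((d:ℝ) - 2) * (∫ x, KE l (-(d:ℝ)) k 0 x * fderiv ℝ φ x x) -
        k * ∫ x, KE l (-(d:ℝ)) (k - 1) 0 x * fderiv ℝ φ x x := by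
  have h1 := limitA hd k hl (lapS φ)
  have h2 := ((limitB hd k hl _ (rad_cont φ) (rad_bound φ)).const_mul ((d:ℝ) - 2)).sub
    ((limitB hd (k-1) hl _ (rad_cont φ) (rad_bound φ)).const_mul (k:ℝ))
  refine tendsto_nhds_unique (h1.congr' ?_) h2
  filter_upwards [self_mem_nhdsWithin] with ε hε using ibp_eps hd k hl hε φ

lemma sphere_area {d : ℕ} (hd : 3 ≤ d) :
    (volume : Measure (EuclideanSpace ℝ (Fin d))).toSphere.real Set.univ = Omega d := by
  have : Nonempty (Fin d) := ⟨⟨0, by omega⟩⟩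
  have hd' : (0:ℝ) < d := by exact_mod_cast (by omega : 0 < d)
  rw [Measure.toSphere_real_apply_univ, measureReal_def, EuclideanSpace.volume_ball]
  have hG : 0 < Real.Gamma ((d:ℝ)/2) := Real.Gamma_pos_of_pos (by positivity)
  simp only [finrank_euclideanSpace, Fintype.card_fin, ENNReal.ofReal_one, one_pow, one_mul]
  rw [Real.Gamma_add_one (by positivity), ENNReal.toReal_ofReal (by positivity), Omega,
    Real.sqrt_eq_rpow, ← Real.rpow_natCast, ← Real.rpow_mul Real.pi_pos.le]
  rw [show (1/2 : ℝ) * d = d / 2 by ring]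
  field_simp

lemma polar_zero {d : ℕ} (hd : 3 ≤ d) (φ : SchwartzMap (EuclideanSpace ℝ (Fin d)) ℝ)
    (hfint : Integrable (fun x => ‖x‖ ^ (-(d:ℝ)) * fderiv ℝ φ x x)) :
    ∫ x, ‖x‖ ^ (-(d:ℝ)) * fderiv ℝ φ x x = -(Omega d * φ 0) := by
  have : Nonempty (Fin d) := ⟨⟨0, by omega⟩⟩
  have : Nontrivial (EuclideanSpace ℝ (Fin d)) := inferInstance
  set f : EuclideanSpace ℝ (Fin d) → ℝ := fun x => ‖x‖ ^ (-(d:ℝ)) * fderiv ℝ φ x x with hf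
  set μ : Measure (EuclideanSpace ℝ (Fin d)) := volume
  let g : Metric.sphere (0 : EuclideanSpace ℝ (Fin d)) 1 × Set.Ioi (0:ℝ) → ℝ :=
    fun p => f (p.2.1 • p.1.1)
  have hmp := μ.measurePreserving_homeomorphUnitSphereProd
  have hg : ∀ x : ({0}ᶜ : Set (EuclideanSpace ℝ (Fin d))),
      g (homeomorphUnitSphereProd _ x) = f x.1 := fun x => by
    have hx : ‖x.1‖ ≠ 0 := norm_ne_zero_iff.2 x.2
    simp only [g, homeomorphUnitSphereProd_apply_snd_coe, homeomorphUnitSphereProd_apply_fst_coe]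
    rw [smul_smul, mul_inv_cancel₀ hx, one_smul]
  have hgi : Integrable g (μ.toSphere.prod
      (.volumeIoiPow (Module.finrank ℝ (EuclideanSpace ℝ (Fin d)) - 1))) := by
    rw [← hmp.integrable_comp_emb (Homeomorph.measurableEmbedding _)]
    have : g ∘ (homeomorphUnitSphereProd (EuclideanSpace ℝ (Fin d))) = f ∘ Subtype.val :=
      funext hg
    rw [this, ← integrableOn_iff_comap_subtypeVal (measurableSet_singleton _).compl]
    exact hfint.integrableOn
  have hfd : (Module.finrank ℝ (EuclideanSpace ℝ (Fin d)) - 1) = d - 1 := by simp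
  have step : ∫ x, f x ∂μ = ∫ p, g p ∂(μ.toSphere.prod
      (.volumeIoiPow (Module.finrank ℝ (EuclideanSpace ℝ (Fin d)) - 1))) := by
    rw [← hmp.integral_comp (Homeomorph.measurableEmbedding _) g]
    simp_rw [hg]
    rw [integral_subtype_comap (measurableSet_singleton _).compl f, restrict_compl_singleton]
  have hval : ∀ (ω : Metric.sphere (0 : EuclideanSpace ℝ (Fin d)) 1) (r : ℝ), 0 < r →
      r ^ (d - 1) * f (r • ω.1) = fderiv ℝ φ (r • ω.1) ω.1 := fun ω r hr => by
    have hω : ‖ω.1‖ = 1 := by simpa using ω.2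
    simp only [hf, norm_smul, hω, map_smul, smul_eq_mul, Real.norm_of_nonneg hr.le, mul_one]
    rw [← mul_assoc, ← mul_assoc, ← Real.rpow_natCast, ← Real.rpow_add hr,
      ← Real.rpow_add_one hr.ne', Nat.cast_sub (by omega), Nat.cast_one,
      show (d:ℝ) - 1 + -(d:ℝ) + 1 = 0 by ring, Real.rpow_zero, one_mul]
  rw [step, integral_prod _ hgi]
  have inner : ∀ᵐ ω ∂μ.toSphere, ∫ r, g (ω, r) ∂(Measure.volumeIoiPow
      (Module.finrank ℝ (EuclideanSpace ℝ (Fin d)) - 1)) = - φ 0 := by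
    filter_upwards [hgi.prod_right_ae] with ω hω
    rw [hfd] at hω ⊢
    have hm : Measurable (fun r : Set.Ioi (0:ℝ) => Real.toNNReal (r.1 ^ (d - 1))) :=
      (measurable_subtype_coe.pow_const _).real_toNNReal
    simp only [Measure.volumeIoiPow, ENNReal.ofReal] at hω ⊢
    rw [integral_withDensity_eq_integral_smul hm]
    rw [integrable_withDensity_iff_integrable_smul hm] at hω
    have hF : ∀ r : Set.Ioi (0:ℝ), Real.toNNReal (r.1 ^ (d - 1)) • g (ω, r) =
        fderiv ℝ φ (r.1 • ω.1) ω.1 := fun r => by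
      rw [NNReal.smul_def, Real.coe_toNNReal _ (pow_nonneg r.2.out.le _), smul_eq_mul]
      exact hval ω r.1 r.2
    simp_rw [hF] at hω ⊢
    have hω' : IntegrableOn (fun r : ℝ => fderiv ℝ φ (r • ω.1) ω.1) (Set.Ioi 0) := by
      rw [integrableOn_iff_comap_subtypeVal measurableSet_Ioi]; exact hω
    rw [integral_subtype_comap measurableSet_Ioi (fun r : ℝ => fderiv ℝ φ (r • ω.1) ω.1)]
    rw [integral_Ioi_of_hasDerivAt_of_tendsto' (f := fun r : ℝ => φ (r • ω.1)) (m := 0) _ hω' _]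
    · simp
    · intro r _
      have h1 : HasDerivAt (fun r : ℝ => r • ω.1) ω.1 r := by
        simpa using (hasDerivAt_id r).smul_const ω.1
      exact (φ.differentiableAt.hasFDerivAt).comp_hasDerivAt r h1
    · have hz := φ.toZeroAtInfty.zero_at_infty'
      refine Filter.Tendsto.comp (g := φ) hz ?_
      rw [← Metric.cobounded_eq_cocompact, ← tendsto_norm_atTop_iff_cobounded]
      have hω1 : ‖ω.1‖ = 1 := by simpa using ω.2
      simp only [norm_smul, hω1, mul_one]
      exact tendsto_norm_atTop_atTop
  rw [integral_congr_ae inner, integral_const, sphere_area hd]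
  simp

lemma telescope (c : ℝ) (A B : ℕ → ℝ) (h : ∀ k, A k = c * B k - k * B (k - 1)) (n : ℕ) :
    ∑ k ∈ Finset.Icc 1 n, c ^ k / (k.factorial : ℝ) * A k =
      c ^ (n + 1) / (n.factorial : ℝ) * B n - c * B 0 := by
  induction n with
  | zero => simp
  | succ n ih =>
    rw [Finset.sum_Icc_succ_top (by omega), ih, h (n + 1), Nat.factorial_succ]
    have : (n.factorial : ℝ) ≠ 0 := by exact_mod_cast n.factorial_ne_zero
    have : (n:ℝ) + 1 ≠ 0 := by positivity
    push_cast
    field_simp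
    ring

/-- the explicit Laplacian form of the renormalized distribution:
`R_d[r^{-d} log^m(r/l)] = - Σ_{k=1}^{m+1} (m!/k!) (d-2)^{k-m-2} Δ(r^{-d+2} log^k(r/l))
  + (m!/(d-2)^{m+1}) Ω_d δ`, all integrals absolutely convergent. -/
theorem stmt_2 (d m : ℕ) (hd : 3 ≤ d) (l : ℝ) (hl : 0 < l)
    (φ : SchwartzMap (EuclideanSpace ℝ (Fin d)) ℝ) :
    Integrable (fun x : EuclideanSpace ℝ (Fin d) =>
        ‖x‖ ^ (-(d : ℝ)) * (Real.log (‖x‖ / l)) ^ (m + 1) * fderiv ℝ (⇑φ) x x) ∧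
    (∀ k ∈ Finset.Icc 1 (m + 1), Integrable (fun x : EuclideanSpace ℝ (Fin d) =>
        ‖x‖ ^ (-(d : ℝ) + 2) * (Real.log (‖x‖ / l)) ^ k * lapl d (⇑φ) x)) ∧
    -(1 / ((m : ℝ) + 1)) *
        (∫ x : EuclideanSpace ℝ (Fin d),
          ‖x‖ ^ (-(d : ℝ)) * (Real.log (‖x‖ / l)) ^ (m + 1) * fderiv ℝ (⇑φ) x x)
      = -(∑ k ∈ Finset.Icc 1 (m + 1),
            ((m.factorial : ℝ) / (k.factorial : ℝ)) * ((d : ℝ) - 2) ^ ((k : ℤ) - (m : ℤ) - 2) *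
              ∫ x : EuclideanSpace ℝ (Fin d),
                ‖x‖ ^ (-(d : ℝ) + 2) * (Real.log (‖x‖ / l)) ^ k * lapl d (⇑φ) x)
        + ((m.factorial : ℝ) / ((d : ℝ) - 2) ^ (m + 1)) * Omega d * φ 0 := by
  have hKE : ∀ (q : ℝ) (k : ℕ) (x : EuclideanSpace ℝ (Fin d)),
      ‖x‖ ^ q * (Real.log (‖x‖ / l)) ^ k = KE l q k 0 x := fun q k x => by
    simp only [KE, sE_zero]
  have hB := fun k => integrableB hd k hl _ (rad_cont φ) (rad_bound φ) le_rfl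
  simp_rw [hKE, ← lapS_apply]
  refine ⟨hB (m + 1), fun k _ => integrableA hd k hl _ le_rfl, ?_⟩
  have h0 : ∫ x, KE l (-(d:ℝ)) 0 0 x * fderiv ℝ φ x x = -(Omega d * φ 0) := by
    have e : ∀ x : EuclideanSpace ℝ (Fin d), KE l (-(d:ℝ)) 0 0 x = ‖x‖ ^ (-(d:ℝ)) := fun x => by
      simp [KE, sE_zero]
    have hi := hB 0
    simp_rw [e] at hi ⊢
    exact polar_zero hd φ hi
  have hd' : (3:ℝ) ≤ d := by exact_mod_cast hd
  have hc : (d:ℝ) - 2 ≠ 0 := by linarith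
  have ht := telescope ((d:ℝ) - 2) (fun k => ∫ x, KE l (-(d:ℝ) + 2) k 0 x * lapS φ x)
    (fun k => ∫ x, KE l (-(d:ℝ)) k 0 x * fderiv ℝ φ x x) (fun k => ibp_zero hd k hl φ) (m + 1)
  simp only [h0] at ht
  have hz : ∀ k : ℕ, ((d : ℝ) - 2) ^ ((k : ℤ) - (m : ℤ) - 2) =
      ((d:ℝ) - 2) ^ k / ((d:ℝ) - 2) ^ (m + 2) := fun k => by
    rw [show (k:ℤ) - m - 2 = (k:ℤ) - ((m + 2 : ℕ) : ℤ) by push_cast; ring, zpow_sub₀ hc,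
      zpow_natCast, zpow_natCast]
  have hsum : ∑ k ∈ Finset.Icc 1 (m + 1),
      ((m.factorial : ℝ) / (k.factorial : ℝ)) * ((d : ℝ) - 2) ^ ((k : ℤ) - (m : ℤ) - 2) *
        ∫ x, KE l (-(d:ℝ) + 2) k 0 x * lapS φ x =
      (m.factorial : ℝ) / ((d:ℝ) - 2) ^ (m + 2) * ∑ k ∈ Finset.Icc 1 (m + 1),
        ((d:ℝ) - 2) ^ k / (k.factorial : ℝ) * ∫ x, KE l (-(d:ℝ) + 2) k 0 x * lapS φ x := by
    rw [Finset.mul_sum]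
    refine Finset.sum_congr rfl fun k _ => ?_
    rw [hz]; ring
  rw [hsum, ht, Nat.factorial_succ]
  have : (m.factorial : ℝ) ≠ 0 := by exact_mod_cast m.factorial_ne_zero
  have : (m:ℝ) + 1 ≠ 0 := by positivity
  generalize (d:ℝ) - 2 = c at hc
  push_cast
  field_simp
  ring

end
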